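/- arXiv:1704.08334 — 2 statements merged into one kernel-verified Lean document; each statement's English description precedes it below -/
import Mathlib

section
/- There exist constants 0 < c ≤ C < ∞ such that for every α ≥ 0 and every ε ∈ (0,1), c · ε^{1/2} ≤ ∫₀^ε p_{2s}(ε^{(1/2)+α}) ds ≤ C · ε^{1/2}. (Equivalently, the covariance of the solution of the constant-coefficient stochastic heat equation at time ε between spatial points 0 and ε^{(1/2)+α} is of sharp order ε^{1/2} uniformly for ε ∈ (0,1) when α ≥ 0.) -/
open MeasureTheory Real

/-- The heat kernel on ℝ: `p r w = (2πr)^{-1/2} exp(-w²/(2r))`. -/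
noncomputable def heatKernel (r w : ℝ) : ℝ :=
  (2 * Real.pi * r) ^ (-(1 : ℝ) / 2) * Real.exp (-w ^ 2 / (2 * r))

theorem heatKernel_nonneg {r : ℝ} (hr : 0 ≤ r) (w : ℝ) : 0 ≤ heatKernel r w := by
  unfold heatKernel
  positivity

theorem heatKernel_two_mul {s : ℝ} (hs : 0 ≤ s) (w : ℝ) :
    heatKernel (2 * s) w =
      (4 * Real.pi) ^ (-(1 : ℝ) / 2) * s ^ (-(1 : ℝ) / 2) * Real.exp (-w ^ 2 / (4 * s)) := by
  unfold heatKernel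
  rw [← Real.mul_rpow (by positivity) hs]
  ring_nf

theorem heatKernel_two_mul_le {s : ℝ} (hs : 0 ≤ s) (w : ℝ) :
    heatKernel (2 * s) w ≤ (4 * Real.pi) ^ (-(1 : ℝ) / 2) * s ^ (-(1 : ℝ) / 2) := by
  rw [heatKernel_two_mul hs]
  refine mul_le_of_le_one_right (by positivity) (Real.exp_le_one_iff.2 ?_)
  exact div_nonpos_of_nonpos_of_nonneg (neg_nonpos.2 (sq_nonneg w)) (by positivity)

theorem le_heatKernel_two_mul {s ε w : ℝ} (hε : 0 < ε) (hs : s ∈ Set.Icc (ε / 2) ε)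
    (hw : w ^ 2 ≤ ε) :
    (4 * Real.pi) ^ (-(1 : ℝ) / 2) * ε ^ (-(1 : ℝ) / 2) * Real.exp (-1 / 2) ≤
      heatKernel (2 * s) w := by
  have hs0 : 0 < s := by linarith [hs.1]
  rw [heatKernel_two_mul hs0.le]
  have hpow : ε ^ (-(1 : ℝ) / 2) ≤ s ^ (-(1 : ℝ) / 2) :=
    Real.rpow_le_rpow_of_nonpos hs0 hs.2 (by norm_num)
  have hexp : (-1 / 2 : ℝ) ≤ -w ^ 2 / (4 * s) := by
    rw [le_div_iff₀ (by positivity)]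
    linarith [hs.1]
  gcongr

theorem intervalIntegrable_four_pi_mul_rpow (a b : ℝ) :
    IntervalIntegrable (fun s : ℝ => (4 * Real.pi) ^ (-(1 : ℝ) / 2) * s ^ (-(1 : ℝ) / 2))
      volume a b :=
  (intervalIntegral.intervalIntegrable_rpow' (by norm_num)).const_mul _

theorem intervalIntegrable_heatKernel {ε : ℝ} (hε : 0 ≤ ε) (w : ℝ) :
    IntervalIntegrable (fun s => heatKernel (2 * s) w) volume 0 ε := by
  refine (intervalIntegrable_four_pi_mul_rpow 0 ε).mono_fun' ?_ ?_
  · refine Measurable.aestronglyMeasurable ?_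
    unfold heatKernel
    fun_prop
  · filter_upwards [ae_restrict_mem measurableSet_uIoc] with s hs
    rw [Set.uIoc_of_le hε] at hs
    rw [Real.norm_of_nonneg (heatKernel_nonneg (by linarith [hs.1]) w)]
    exact heatKernel_two_mul_le hs.1.le w

theorem integral_heatKernel_le {ε : ℝ} (hε : 0 ≤ ε) (w : ℝ) :
    (∫ s in (0 : ℝ)..ε, heatKernel (2 * s) w) ≤
      2 * (4 * Real.pi) ^ (-(1 : ℝ) / 2) * ε ^ ((1 : ℝ) / 2) := by
  refine (intervalIntegral.integral_mono_on hε (intervalIntegrable_heatKernel hε w)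
    (intervalIntegrable_four_pi_mul_rpow 0 ε)
    fun s hs => heatKernel_two_mul_le hs.1 w).trans_eq ?_
  rw [intervalIntegral.integral_const_mul, integral_rpow (Or.inl (by norm_num)),
    show (-(1 : ℝ) / 2 + 1) = 1 / 2 by norm_num, Real.zero_rpow (by norm_num)]
  ring

theorem le_integral_heatKernel {ε w : ℝ} (hε : 0 < ε) (hw : w ^ 2 ≤ ε) :
    (4 * Real.pi) ^ (-(1 : ℝ) / 2) * Real.exp (-1 / 2) / 2 * ε ^ ((1 : ℝ) / 2) ≤
      ∫ s in (0 : ℝ)..ε, heatKernel (2 * s) w := by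
  have hint := intervalIntegrable_heatKernel hε.le w
  have hle : ε / 2 ≤ ε := by linarith
  calc _ = ∫ _ in (ε / 2)..ε,
        (4 * Real.pi) ^ (-(1 : ℝ) / 2) * ε ^ (-(1 : ℝ) / 2) * Real.exp (-1 / 2) := by
        rw [intervalIntegral.integral_const, smul_eq_mul,
          show (1 : ℝ) / 2 = -1 / 2 + 1 by norm_num, Real.rpow_add_one hε.ne']
        ring
    _ ≤ ∫ s in (ε / 2)..ε, heatKernel (2 * s) w := by
        refine intervalIntegral.integral_mono_on hle intervalIntegrable_const
          (hint.mono_set ?_) fun s hs => le_heatKernel_two_mul hε hs hw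
        rw [Set.uIcc_of_le hle, Set.uIcc_of_le hε.le]
        exact Set.Icc_subset_Icc_left (by positivity)
    _ ≤ ∫ s in (0 : ℝ)..ε, heatKernel (2 * s) w := by
        refine intervalIntegral.integral_mono_interval (by positivity) hle le_rfl ?_ hint
        filter_upwards [ae_restrict_mem measurableSet_Ioc] with s hs
        exact heatKernel_nonneg (by linarith [hs.1]) w

/-- For `α ≥ 0`, the covariance `∫₀^ε p_{2s}(ε^{1/2+α}) ds` of the
constant-coefficient stochastic heat equation is of sharp order `ε^{1/2}`,
uniformly for `ε ∈ (0,1)`. -/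
theorem covariance_order_alpha_nonneg :
    ∃ c C : ℝ, 0 < c ∧ c ≤ C ∧
      ∀ α : ℝ, 0 ≤ α → ∀ ε ∈ Set.Ioo (0 : ℝ) 1,
        c * ε ^ ((1 : ℝ) / 2) ≤
            (∫ s in (0 : ℝ)..ε, heatKernel (2 * s) (ε ^ ((1 : ℝ) / 2 + α))) ∧
          (∫ s in (0 : ℝ)..ε, heatKernel (2 * s) (ε ^ ((1 : ℝ) / 2 + α))) ≤
            C * ε ^ ((1 : ℝ) / 2) := by
  refine ⟨(4 * Real.pi) ^ (-(1 : ℝ) / 2) * Real.exp (-1 / 2) / 2,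
    2 * (4 * Real.pi) ^ (-(1 : ℝ) / 2), by positivity, ?_, fun α hα ε hε => ⟨?_, ?_⟩⟩
  · have hexp : Real.exp (-1 / 2) ≤ 1 := Real.exp_le_one_iff.2 (by norm_num)
    have hpos : 0 < (4 * Real.pi) ^ (-(1 : ℝ) / 2) := by positivity
    nlinarith
  · refine le_integral_heatKernel hε.1 ?_
    rw [← Real.rpow_natCast, ← Real.rpow_mul hε.1.le]
    refine (Real.rpow_le_rpow_of_exponent_ge hε.1 hε.2.le ?_).trans_eq (Real.rpow_one ε)
    push_cast
    linarith
  · exact integral_heatKernel_le hε.1.le _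
end

section
/- For every ε ∈ (0,1) and every δ ∈ (0, 1/(2π^{1/4})), ∫₀^ε ∫_{{y ∈ ℝ : |y| ≤ √(2ε log(1/δ))}} (p_s(y))² dy ds ≥ ε^{1/2} (1 − δ π^{1/4})² / √π. (This is the lower bound on the variance of the spatially truncated solution of the constant-coefficient stochastic heat equation at time ε used in the lower-bound hitting estimate.) -/
open MeasureTheory Real

lemma heatKernel_sq {s : ℝ} (hs : 0 < s) (y : ℝ) :
    heatKernel s y ^ 2 = (2 * π * s)⁻¹ * exp (-s⁻¹ * y ^ 2) := by
  have h : 0 < 2 * π * s := by positivity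
  rw [heatKernel, mul_pow, ← rpow_natCast, ← rpow_mul h.le, ← exp_nat_mul]
  congr 1
  · norm_num [rpow_neg_one]
  · congr 1
    push_cast
    field_simp

lemma measurable_heatKernel : Measurable (Function.uncurry heatKernel) := by
  unfold heatKernel Function.uncurry
  fun_prop

lemma integrable_heatKernel_sq {s : ℝ} (hs : 0 < s) :
    Integrable fun y => heatKernel s y ^ 2 := by
  simp_rw [heatKernel_sq hs]
  exact (integrable_exp_neg_mul_sq (inv_pos.2 hs)).const_mul _

lemma inv_mul_sqrt_pi_mul {s : ℝ} (hs : 0 < s) :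
    (2 * π * s)⁻¹ * √(π * s) = (2 * √π)⁻¹ * s ^ (-(1 : ℝ) / 2) := by
  have h1 : √s ^ 2 = s := sq_sqrt hs.le
  have h2 : √π ^ 2 = π := sq_sqrt pi_pos.le
  have h3 : 0 < √s := sqrt_pos.2 hs
  have h4 : 0 < √π := sqrt_pos.2 pi_pos
  rw [neg_div, rpow_neg hs.le, ← sqrt_eq_rpow, sqrt_mul pi_pos.le]
  nth_rewrite 1 [← h1, ← h2]
  field_simp

lemma integral_heatKernel_sq {s : ℝ} (hs : 0 < s) :
    ∫ y, heatKernel s y ^ 2 = (2 * √π)⁻¹ * s ^ (-(1 : ℝ) / 2) := by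
  simp_rw [heatKernel_sq hs]
  rw [integral_const_mul, integral_gaussian, div_inv_eq_mul, inv_mul_sqrt_pi_mul hs]

lemma measurableSet_abs_le (R : ℝ) : MeasurableSet {y : ℝ | |y| ≤ R} :=
  measurableSet_le measurable_abs measurable_const

lemma setIntegral_heatKernel_sq_ge {s R η : ℝ} (hs : 0 < s) (hη : exp (-R ^ 2 / (2 * s)) ≤ η)
    (hR : 0 ≤ R) :
    (1 - √2 * η) * ((2 * √π)⁻¹ * s ^ (-(1 : ℝ) / 2)) ≤
      ∫ y in {y : ℝ | |y| ≤ R}, heatKernel s y ^ 2 := by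
  have hη0 : 0 ≤ η := (exp_pos _).le.trans hη
  have h2s : 0 < (2 * s)⁻¹ := by positivity
  have i1 := integrable_heatKernel_sq hs
  have i2 : Integrable fun y : ℝ => (2 * π * s)⁻¹ * (η * exp (-(2 * s)⁻¹ * y ^ 2)) :=
    ((integrable_exp_neg_mul_sq h2s).const_mul _).const_mul _
  have h2 : ∫ y : ℝ, (2 * π * s)⁻¹ * (η * exp (-(2 * s)⁻¹ * y ^ 2)) =
      √2 * η * ((2 * √π)⁻¹ * s ^ (-(1 : ℝ) / 2)) := by
    rw [integral_const_mul, integral_const_mul, integral_gaussian, div_inv_eq_mul,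
      ← inv_mul_sqrt_pi_mul hs, show π * (2 * s) = 2 * (π * s) by ring, sqrt_mul zero_le_two]
    ring
  rw [sub_mul, one_mul, ← h2, ← integral_heatKernel_sq hs, ← integral_sub i1 i2,
    ← integral_indicator (measurableSet_abs_le R)]
  refine integral_mono (i1.sub i2) (i1.indicator (measurableSet_abs_le R)) fun y => ?_
  by_cases hy : |y| ≤ R
  · rw [Set.indicator_of_mem (by exact hy)]
    exact sub_le_self _ (by positivity)
  · rw [Set.indicator_of_notMem (by exact hy)]
    simp only [heatKernel_sq hs, ← mul_sub]
    refine mul_nonpos_of_nonneg_of_nonpos (by positivity) (sub_nonpos.2 ?_)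
    have hRy : R ^ 2 ≤ y ^ 2 := by
      rw [← sq_abs y]
      exact pow_le_pow_left₀ hR (not_le.1 hy).le 2
    calc exp (-s⁻¹ * y ^ 2) = exp (-y ^ 2 / (2 * s)) * exp (-(2 * s)⁻¹ * y ^ 2) := by
          rw [← exp_add]
          congr 1
          field_simp
          ring
      _ ≤ η * exp (-(2 * s)⁻¹ * y ^ 2) := by
          gcongr
          refine le_trans ?_ hη
          gcongr

lemma intervalIntegrable_setIntegral_heatKernel_sq {ε : ℝ} (hε : 0 ≤ ε) (R : ℝ) :
    IntervalIntegrable (fun s => ∫ y in {y : ℝ | |y| ≤ R}, heatKernel s y ^ 2) volume 0 ε := by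
  have hdom : IntervalIntegrable (fun s : ℝ => (2 * √π)⁻¹ * s ^ (-(1 : ℝ) / 2)) volume 0 ε :=
    (intervalIntegral.intervalIntegrable_rpow' (by norm_num)).const_mul _
  refine hdom.mono_fun' ?_ ?_
  · exact ((measurable_heatKernel.pow_const 2).stronglyMeasurable.integral_prod_right
      (f := fun s y => heatKernel s y ^ 2)).aestronglyMeasurable
  · rw [Set.uIoc_of_le hε]
    filter_upwards [ae_restrict_mem measurableSet_Ioc] with s hs
    rw [norm_of_nonneg (integral_nonneg fun y => sq_nonneg _), ← integral_heatKernel_sq hs.1]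
    exact setIntegral_le_integral (integrable_heatKernel_sq hs.1)
      (Filter.Eventually.of_forall fun y => sq_nonneg _)

/-- For `ε ∈ (0,1)` and `δ ∈ (0, 1/(2π^{1/4}))`, the variance of the spatially
truncated solution of the constant-coefficient stochastic heat equation at
time `ε` satisfies
`∫₀^ε ∫_{|y| ≤ √(2ε log(1/δ))} (p_s(y))² dy ds ≥ ε^{1/2} (1 − δ π^{1/4})² / √π`. -/
theorem truncated_variance_lower_bound (ε δ : ℝ) (hε : ε ∈ Set.Ioo (0 : ℝ) 1)
    (hδ : δ ∈ Set.Ioo (0 : ℝ) (1 / (2 * Real.pi ^ ((1 : ℝ) / 4)))) :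
    (∫ s in (0 : ℝ)..ε,
        ∫ y in {y : ℝ | |y| ≤ Real.sqrt (2 * ε * Real.log (1 / δ))},
          (heatKernel s y) ^ 2) ≥
      ε ^ ((1 : ℝ) / 2) * (1 - δ * Real.pi ^ ((1 : ℝ) / 4)) ^ 2 / Real.sqrt Real.pi := by
  obtain ⟨hε0, -⟩ := hε
  obtain ⟨hδ0, hδ1⟩ := hδ
  set c : ℝ := π ^ ((1 : ℝ) / 4)
  have hc : 1 ≤ c := one_le_rpow (by linarith [pi_gt_three]) (by norm_num)
  have hδc : δ * c < 1 / 2 := by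
    rw [lt_div_iff₀ (by positivity)] at hδ1
    linarith
  have hL : 0 ≤ log (1 / δ) := log_nonneg (by rw [le_div_iff₀ hδ0]; nlinarith)
  set R := √(2 * ε * log (1 / δ))
  have hR2 : R ^ 2 = 2 * ε * log (1 / δ) := sq_sqrt (by positivity)
  have key : ∀ s ∈ Set.Ioo 0 ε, (1 - √2 * δ) * ((2 * √π)⁻¹ * s ^ (-(1 : ℝ) / 2)) ≤
      ∫ y in {y : ℝ | |y| ≤ R}, heatKernel s y ^ 2 := fun s hs => by
    refine setIntegral_heatKernel_sq_ge hs.1 ?_ (sqrt_nonneg _)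
    rw [← le_log_iff_exp_le hδ0, hR2, div_le_iff₀ (by linarith [hs.1])]
    rw [one_div, log_inv] at hL ⊢
    nlinarith [hs.2]
  have hint : IntervalIntegrable
      (fun s : ℝ => (1 - √2 * δ) * ((2 * √π)⁻¹ * s ^ (-(1 : ℝ) / 2))) volume 0 ε :=
    ((intervalIntegral.intervalIntegrable_rpow' (by norm_num)).const_mul _).const_mul _
  refine le_trans ?_ (intervalIntegral.integral_mono_on_of_le_Ioo hε0.le hint
    (intervalIntegrable_setIntegral_heatKernel_sq hε0.le R) key)
  rw [intervalIntegral.integral_const_mul, intervalIntegral.integral_const_mul,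
    integral_rpow (Or.inl (by norm_num))]
  have hsqrt2 : √2 ≤ 3 / 2 := by
    rw [sqrt_le_left (by norm_num)]
    norm_num
  have hmain : (1 - δ * c) ^ 2 ≤ 1 - √2 * δ := by
    nlinarith [mul_le_mul_of_nonneg_left hc hδ0.le, mul_le_mul_of_nonneg_right hsqrt2 hδ0.le,
      mul_nonneg (mul_nonneg hδ0.le (zero_le_one.trans hc)) (sub_nonneg.2 hδc.le)]
  have hexp : (-(1 : ℝ) / 2 + 1) = 1 / 2 := by norm_num
  rw [hexp, zero_rpow (by norm_num), sub_zero]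
  calc ε ^ ((1 : ℝ) / 2) * (1 - δ * c) ^ 2 / √π
      ≤ ε ^ ((1 : ℝ) / 2) * (1 - √2 * δ) / √π := by gcongr
    _ = _ := by
      field_simp
end
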